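/- Every isosceles trapezoid is pedal equivalent to every square: if T = (T_1,T_2,T_3,T_4) is an isosceles trapezoid and V = (V_1,V_2,V_3,V_4) is a square in ℝ², then T ⊥ V. -/

import Mathlib

open scoped InnerProductSpace

noncomputable section

/-- The Euclidean plane. -/
abbrev Plane := EuclideanSpace ℝ (Fin 2)

/-- The foot of the perpendicular from `X` to the line through `A` and `B`
(the orthogonal projection of `X` onto that line, when `A ≠ B`). -/
noncomputable def foot (A B X : Plane) : Plane :=
  A + (⟪X - A, B - A⟫_ℝ / ⟪B - A, B - A⟫_ℝ) • (B - A)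

/-- The pedal polygon of the `n`-gon `V` with respect to the point `X`:
its `i`-th vertex is the orthogonal projection of `X` onto the line through
`V i` and `V (i+1)` (indices mod `n`). -/
noncomputable def pedal {n : ℕ} (V : ZMod n → Plane) (X : Plane) : ZMod n → Plane :=
  fun i => foot (V i) (V (i + 1)) X

/-- No three successive vertices of the `n`-gon `V` are collinear. -/
def NoThreeCollinear {n : ℕ} (V : ZMod n → Plane) : Prop :=
  ∀ i : ZMod n, ¬ Collinear ℝ ({V i, V (i + 1), V (i + 2)} : Set Plane)

/-- Two `n`-gons are similar: there are `k > 0` and a bijection `τ` of `ZMod n` of the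
form `τ i = c + i` or `τ i = c - i` such that `dist (P (τ i)) (P (τ j)) = k * dist (W i) (W j)`. -/
def SimilarGon {n : ℕ} (P W : ZMod n → Plane) : Prop :=
  ∃ k : ℝ, 0 < k ∧ ∃ c : ZMod n,
    ((∀ i j : ZMod n, dist (P (c + i)) (P (c + j)) = k * dist (W i) (W j)) ∨
     (∀ i j : ZMod n, dist (P (c - i)) (P (c - j)) = k * dist (W i) (W j)))

/-- The sequence of iterated pedal polygons of `V` with respect to the points
`X 1, X 2, …` : `pedalSeq V X 0 = V` and `pedalSeq V X k = pedal (pedalSeq V X (k-1)) (X k)`. -/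
noncomputable def pedalSeq {n : ℕ} (V : ZMod n → Plane) (X : ℕ → Plane) : ℕ → ZMod n → Plane
  | 0 => V
  | k + 1 => pedal (pedalSeq V X k) (X (k + 1))

/-- `V` and `W` are pedal equivalent (`V ⊥ W`): some iterated pedal polygon of `V`
(all of whose stages have no three successive vertices collinear) is similar to `W`. -/
def PedalEquiv {n : ℕ} (V W : ZMod n → Plane) : Prop :=
  ∃ m : ℕ, 1 ≤ m ∧ ∃ X : ℕ → Plane,
    (∀ k : ℕ, 1 ≤ k → k ≤ m → NoThreeCollinear (pedalSeq V X k)) ∧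
    SimilarGon (pedalSeq V X m) W

/-- A rectangle: a 4-gon with nonzero, pairwise-orthogonal consecutive edge vectors. -/
def IsRectangle (R : ZMod 4 → Plane) : Prop :=
  ∀ i : ZMod 4, R (i + 1) ≠ R i ∧ ⟪R (i + 1) - R i, R (i + 2) - R (i + 1)⟫_ℝ = 0

/-- A square: a rectangle all of whose sides have the same length. -/
def IsSquareGon (V : ZMod 4 → Plane) : Prop :=
  IsRectangle V ∧ ∀ i j : ZMod 4, dist (V i) (V (i + 1)) = dist (V j) (V (j + 1))

/-- Reflection of the plane across the line through `p` with unit direction `v`. -/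
noncomputable def reflLine (p v x : Plane) : Plane :=
  (2 : ℝ) • (p + ⟪x - p, v⟫_ℝ • v) - x

/-- An isosceles trapezoid: a 4-gon `(T₁,T₂,T₃,T₄)` (here indexed `0,1,2,3`) with no three
successive vertices collinear admitting a reflection across a line with
`T₁ ↔ T₂` and `T₃ ↔ T₄`. -/
def IsIsoscelesTrapezoid (T : ZMod 4 → Plane) : Prop :=
  NoThreeCollinear T ∧ ∃ p v : Plane, ‖v‖ = 1 ∧
    reflLine p v (T 0) = T 1 ∧ reflLine p v (T 1) = T 0 ∧
    reflLine p v (T 2) = T 3 ∧ reflLine p v (T 3) = T 2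

/-- The quadrilateral with vertices `A`, `B`, `C`, `D`. -/
def quad (A B C D : Plane) : ZMod 4 → Plane := ![A, B, C, D]

/-- The point with coordinates `(x, y)` in the frame with origin `p` and axes `w`, `v`. -/
def framePoint (p w v : Plane) (x y : ℝ) : Plane := p + x • w + y • v

theorem forall_zmod_four {P : ZMod 4 → Prop} : (∀ i, P i) ↔ P 0 ∧ P 1 ∧ P 2 ∧ P 3 := by
  refine ⟨fun h => ⟨h 0, h 1, h 2, h 3⟩, fun ⟨h0, h1, h2, h3⟩ i => ?_⟩
  fin_cases i
  exacts [h0, h1, h2, h3]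

theorem eq_quad (T : ZMod 4 → Plane) : T = quad (T 0) (T 1) (T 2) (T 3) :=
  funext (forall_zmod_four.2 ⟨rfl, rfl, rfl, rfl⟩)

theorem pedal_quad (A B C D X : Plane) :
    pedal (quad A B C D) X = quad (foot A B X) (foot B C X) (foot C D X) (foot D A X) :=
  funext (forall_zmod_four.2 ⟨rfl, rfl, rfl, rfl⟩)

theorem noThreeCollinear_quad (A B C D : Plane) :
    NoThreeCollinear (quad A B C D) ↔
      ¬ Collinear ℝ {A, B, C} ∧ ¬ Collinear ℝ {B, C, D} ∧
        ¬ Collinear ℝ {C, D, A} ∧ ¬ Collinear ℝ {D, A, B} :=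
  forall_zmod_four

theorem isSquareGon_quad {A B C D : Plane} (hAB : A ≠ B)
    (h0 : ⟪B - A, C - B⟫_ℝ = 0) (h1 : ⟪C - B, D - C⟫_ℝ = 0)
    (h2 : ⟪D - C, A - D⟫_ℝ = 0) (h3 : ⟪A - D, B - A⟫_ℝ = 0)
    (d1 : dist B C = dist A B) (d2 : dist C D = dist A B) (d3 : dist D A = dist A B) :
    IsSquareGon (quad A B C D) := by
  have hd : ∀ i, dist (quad A B C D i) (quad A B C D (i + 1)) = dist A B :=
    forall_zmod_four.2 ⟨rfl, d1, d2, d3⟩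
  have hi : ∀ i, ⟪quad A B C D (i + 1) - quad A B C D i,
      quad A B C D (i + 2) - quad A B C D (i + 1)⟫_ℝ = 0 :=
    forall_zmod_four.2 ⟨h0, h1, h2, h3⟩
  refine ⟨fun i => ⟨fun h => hAB ?_, hi i⟩, fun i j => (hd i).trans (hd j).symm⟩
  rw [← dist_eq_zero, ← hd i, h, dist_self]

section Square

variable {V W : ZMod 4 → Plane}

theorem IsSquareGon.dist_diag (hV : IsSquareGon V) (i : ZMod 4) :
    dist (V i) (V (i + 2)) = √2 * dist (V 0) (V 1) := by
  have ho := (hV.1 i).2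
  have h1 : ‖V (i + 1) - V i‖ = dist (V 0) (V 1) := by
    rw [← dist_eq_norm, dist_comm]; exact hV.2 i 0
  have h2 : ‖V (i + 2) - V (i + 1)‖ = dist (V 0) (V 1) := by
    rw [← dist_eq_norm, dist_comm]
    have := hV.2 (i + 1) 0
    rwa [add_assoc] at this
  have h3 : dist (V i) (V (i + 2)) ^ 2 = 2 * dist (V 0) (V 1) ^ 2 := by
    rw [dist_comm, dist_eq_norm,
      show V (i + 2) - V i = (V (i + 1) - V i) + (V (i + 2) - V (i + 1)) by abel,
      norm_add_sq_real, ho, h1, h2]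
    ring
  rw [← Real.sqrt_sq (dist_nonneg (x := V i)), h3, Real.sqrt_mul (by norm_num),
    Real.sqrt_sq dist_nonneg]

theorem IsSquareGon.dist_pos (hV : IsSquareGon V) : 0 < dist (V 0) (V 1) :=
  _root_.dist_pos.2 (hV.1 0).1.symm

theorem IsSquareGon.noThreeCollinear (hV : IsSquareGon V) : NoThreeCollinear V := by
  intro i hc
  obtain ⟨hne, ho⟩ := hV.1 i
  have hne' := (hV.1 (i + 1)).1
  rw [add_assoc] at hne'
  obtain ⟨d, hd⟩ := (collinear_iff_of_mem (p₀ := V (i + 1)) (by simp)).1 hc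
  obtain ⟨r, hr⟩ := hd (V i) (by simp)
  obtain ⟨q, hq⟩ := hd (V (i + 2)) (by simp)
  rw [vadd_eq_add] at hr hq
  rw [hr, hq] at ho
  simp only [sub_add_cancel_right, add_sub_cancel_right, inner_neg_left, real_inner_smul_left,
    real_inner_smul_right, neg_eq_zero, mul_eq_zero, inner_self_eq_zero] at ho
  rcases ho with h | h | h
  · exact hne' (by
      rw [show (1 : ZMod 4) + 1 = 2 from rfl, hq, h, zero_smul, zero_add])
  · exact hne (by simp [hr, h])
  · exact hne (by simp [hr, h])

theorem IsSquareGon.similarGon (hV : IsSquareGon V) (hW : IsSquareGon W) : SimilarGon V W := by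
  refine ⟨dist (V 0) (V 1) / dist (W 0) (W 1), div_pos hV.dist_pos hW.dist_pos, 0, Or.inl ?_⟩
  have hk : dist (V 0) (V 1) =
      dist (V 0) (V 1) / dist (W 0) (W 1) * dist (W 0) (W 1) :=
    (div_mul_cancel₀ _ hW.dist_pos.ne').symm
  generalize dist (V 0) (V 1) / dist (W 0) (W 1) = k at hk ⊢
  have side : ∀ i, dist (V i) (V (i + 1)) = k * dist (W i) (W (i + 1)) := fun i => by
    rw [hV.2 i 0, hW.2 i 0]; exact hk
  have diag : ∀ i, dist (V i) (V (i + 2)) = k * dist (W i) (W (i + 2)) := fun i => by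
    rw [hV.dist_diag, hW.dist_diag, hk]; ring
  intro i j
  rw [zero_add, zero_add]
  obtain ⟨m, rfl⟩ : ∃ m, j = i + m := ⟨j - i, by ring⟩
  revert m
  refine forall_zmod_four.2 ⟨by simp, side i, diag i, ?_⟩
  have h := side (i + 3)
  rwa [add_assoc, show (3 : ZMod 4) + 1 = 0 from rfl, add_zero, dist_comm,
    dist_comm (W _)] at h

end Square

section Frame

variable {p w v : Plane}

theorem inner_framePoint_sub (hw : ⟪w, w⟫_ℝ = 1) (hv : ⟪v, v⟫_ℝ = 1) (hwv : ⟪w, v⟫_ℝ = 0)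
    (a b c d e f g h : ℝ) :
    ⟪framePoint p w v a b - framePoint p w v c d,
      framePoint p w v e f - framePoint p w v g h⟫_ℝ = (a - c) * (e - g) + (b - d) * (f - h) := by
  have hvw : ⟪v, w⟫_ℝ = 0 := by rw [real_inner_comm, hwv]
  have key : ∀ a b c d : ℝ, framePoint p w v a b - framePoint p w v c d
      = (a - c) • w + (b - d) • v := fun a b c d => by
    unfold framePoint; module
  rw [key, key]
  simp only [inner_add_left, inner_add_right, real_inner_smul_left, real_inner_smul_right,
    hw, hv, hwv, hvw]
  ring

theorem dist_framePoint (hw : ⟪w, w⟫_ℝ = 1) (hv : ⟪v, v⟫_ℝ = 1) (hwv : ⟪w, v⟫_ℝ = 0)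
    (a b c d : ℝ) :
    dist (framePoint p w v a b) (framePoint p w v c d) = √((a - c) ^ 2 + (b - d) ^ 2) := by
  rw [dist_eq_norm, norm_eq_sqrt_real_inner, inner_framePoint_sub hw hv hwv]
  ring_nf

theorem foot_framePoint (hw : ⟪w, w⟫_ℝ = 1) (hv : ⟪v, v⟫_ℝ = 1) (hwv : ⟪w, v⟫_ℝ = 0)
    {a b c d x y f g : ℝ} (r : ℝ) (hne : c - a ≠ 0 ∨ d - b ≠ 0)
    (hr : (x - a) * (c - a) + (y - b) * (d - b) = r * ((c - a) ^ 2 + (d - b) ^ 2))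
    (hf : f = a + r * (c - a)) (hg : g = b + r * (d - b)) :
    foot (framePoint p w v a b) (framePoint p w v c d) (framePoint p w v x y)
      = framePoint p w v f g := by
  have hpos : (c - a) ^ 2 + (d - b) ^ 2 ≠ 0 := by
    rcases hne with h | h <;> positivity
  rw [foot, inner_framePoint_sub hw hv hwv, inner_framePoint_sub hw hv hwv, hr, ← pow_two,
    ← pow_two, mul_div_cancel_right₀ _ hpos, hf, hg]
  unfold framePoint
  module

theorem not_collinear_framePoint (hw : ⟪w, w⟫_ℝ = 1) (hv : ⟪v, v⟫_ℝ = 1) (hwv : ⟪w, v⟫_ℝ = 0)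
    {a b c d e f : ℝ} (h : (c - a) * (f - b) - (d - b) * (e - a) ≠ 0) :
    ¬ Collinear ℝ {framePoint p w v a b, framePoint p w v c d, framePoint p w v e f} := by
  have hvw : ⟪v, w⟫_ℝ = 0 := by rw [real_inner_comm, hwv]
  intro hc
  obtain ⟨z, hz⟩ := (collinear_iff_of_mem (p₀ := framePoint p w v a b) (by simp)).1 hc
  have key : ∀ x y : ℝ, (∃ r : ℝ, framePoint p w v x y = r • z +ᵥ framePoint p w v a b) →
      ∃ r : ℝ, x - a = r * ⟪z, w⟫_ℝ ∧ y - b = r * ⟪z, v⟫_ℝ := by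
    rintro x y ⟨r, hr⟩
    have hr' : (x - a) • w + (y - b) • v = r • z := by
      rw [vadd_eq_add, ← sub_eq_iff_eq_add] at hr
      rw [← hr]
      unfold framePoint
      module
    refine ⟨r, ?_, ?_⟩
    · have := congrArg (⟪·, w⟫_ℝ) hr'
      simpa only [inner_add_left, real_inner_smul_left, hw, hvw, mul_one, mul_zero, add_zero]
        using this
    · have := congrArg (⟪·, v⟫_ℝ) hr'
      simpa only [inner_add_left, real_inner_smul_left, hv, hwv, mul_one, mul_zero, zero_add]
        using this
  obtain ⟨r, h1, h2⟩ := key c d (hz _ (by simp))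
  obtain ⟨q, h3, h4⟩ := key e f (hz _ (by simp))
  apply h
  rw [h1, h2, h3, h4]
  ring

theorem collinear_framePoint_same_height (a b c y : ℝ) :
    Collinear ℝ {framePoint p w v a y, framePoint p w v b y, framePoint p w v c y} := by
  refine (collinear_iff_exists_forall_eq_smul_vadd _).2 ⟨framePoint p w v 0 y, w, ?_⟩
  simp only [Set.mem_insert_iff, Set.mem_singleton_iff, framePoint, vadd_eq_add]
  rintro _ (rfl | rfl | rfl)
  exacts [⟨a, by module⟩, ⟨b, by module⟩, ⟨c, by module⟩]

end Frame

theorem exists_unit_normal {v : Plane} (hv : ‖v‖ = 1) :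
    ∃ w : Plane, ⟪w, w⟫_ℝ = 1 ∧ ⟪v, v⟫_ℝ = 1 ∧ ⟪w, v⟫_ℝ = 0 ∧
      ∀ x, x = ⟪x, w⟫_ℝ • w + ⟪x, v⟫_ℝ • v := by
  have h : v 0 ^ 2 + v 1 ^ 2 = 1 := by
    have := EuclideanSpace.norm_sq_eq v
    simpa [hv, Fin.sum_univ_two] using this.symm
  refine ⟨!₂[-v 1, v 0], ?_, ?_, ?_, fun x => ?_⟩
  · simp only [PiLp.inner_apply, Fin.sum_univ_two]; simp; linear_combination h
  · rw [real_inner_self_eq_norm_sq, hv, one_pow]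
  · simp [PiLp.inner_apply, Fin.sum_univ_two]; ring
  · ext i
    fin_cases i
    · simp [PiLp.inner_apply, Fin.sum_univ_two]; linear_combination (-x 0) * h
    · simp [PiLp.inner_apply, Fin.sum_univ_two]; linear_combination (-x 1) * h

theorem IsIsoscelesTrapezoid.exists_coordinates {T : ZMod 4 → Plane}
    (hT : IsIsoscelesTrapezoid T) :
    ∃ p w v : Plane, ⟪w, w⟫_ℝ = 1 ∧ ⟪v, v⟫_ℝ = 1 ∧ ⟪w, v⟫_ℝ = 0 ∧
      ∃ a b s t : ℝ, a ≠ 0 ∧ b ≠ 0 ∧ t - s ≠ 0 ∧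
        T = quad (framePoint p w v (-a) s) (framePoint p w v a s)
          (framePoint p w v b t) (framePoint p w v (-b) t) := by
  obtain ⟨hc, p, v, hv, h01, -, h23, -⟩ := hT
  obtain ⟨w, hw, hvv, hwv, hx⟩ := exists_unit_normal hv
  have hpt : ∀ x, x = framePoint p w v ⟪x - p, w⟫_ℝ ⟪x - p, v⟫_ℝ := fun x => by
    rw [framePoint, add_assoc, ← hx (x - p), add_sub_cancel]
  have hrefl : ∀ x, reflLine p v x = framePoint p w v (-⟪x - p, w⟫_ℝ) ⟪x - p, v⟫_ℝ := fun x => by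
    rw [reflLine]
    nth_rw 2 [hpt x]
    unfold framePoint
    module
  have hTq : T = quad (framePoint p w v (-(-⟪T 0 - p, w⟫_ℝ)) ⟪T 0 - p, v⟫_ℝ)
      (framePoint p w v (-⟪T 0 - p, w⟫_ℝ) ⟪T 0 - p, v⟫_ℝ)
      (framePoint p w v ⟪T 2 - p, w⟫_ℝ ⟪T 2 - p, v⟫_ℝ)
      (framePoint p w v (-⟪T 2 - p, w⟫_ℝ) ⟪T 2 - p, v⟫_ℝ) := by
    rw [← hrefl, ← hrefl, neg_neg, ← hpt, ← hpt, h01, h23]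
    exact eq_quad T
  refine ⟨p, w, v, hw, hvv, hwv, _, _, _, _, ?_, ?_, ?_, hTq⟩
  all_goals
    rw [hTq, noThreeCollinear_quad] at hc
    obtain ⟨h0, h1, -, -⟩ := hc
    intro h
  · rw [h, neg_zero, Set.insert_eq_of_mem (Set.mem_insert _ _)] at h0
    exact h0 (collinear_pair ℝ _ _)
  · rw [h, neg_zero, Set.pair_eq_singleton] at h1
    exact h1 (collinear_pair ℝ _ _)
  · rw [sub_eq_zero.1 h] at h0
    exact h0 (collinear_framePoint_same_height _ _ _ _)

theorem exists_kite_parameter {a b D : ℝ} (ha : a ≠ 0) (hD : D ≠ 0) :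
    ∃ r E : ℝ, E ^ 2 = 4 * D ^ 2 ∧ a + r * (b - a) = E * r * (1 - r) ∧
      1 + 4 * r * (1 - r) ≠ 0 := by
  obtain ⟨E, hE, hEa⟩ : ∃ E : ℝ, E ^ 2 = 4 * D ^ 2 ∧ E * a < 0 := by
    rcases lt_or_gt_of_ne (mul_ne_zero hD ha) with h | h
    · exact ⟨2 * D, by ring, by linarith⟩
    · exact ⟨-2 * D, by ring, by linarith⟩
  have hE0 : E ≠ 0 := by rintro rfl; simp at hEa
  have hdisc : 0 < (b - a - E) ^ 2 - 4 * (E * a) := by nlinarith [sq_nonneg (b - a - E)]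
  obtain ⟨S, hS0, hS⟩ : ∃ S : ℝ, S ≠ 0 ∧ S ^ 2 = (b - a - E) ^ 2 - 4 * (E * a) :=
    ⟨_, (Real.sqrt_pos.2 hdisc).ne', Real.sq_sqrt hdisc.le⟩
  have root : ∀ z : ℝ, z ^ 2 = S ^ 2 →
      a + ((z - (b - a - E)) / (2 * E)) * (b - a)
        = E * ((z - (b - a - E)) / (2 * E)) * (1 - (z - (b - a - E)) / (2 * E)) := by
    intro z hz
    field_simp
    linear_combination hz + hS
  by_cases h1 : 1 + 4 * ((S - (b - a - E)) / (2 * E)) * (1 - (S - (b - a - E)) / (2 * E)) = 0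
  · by_cases h2 : 1 + 4 * ((-S - (b - a - E)) / (2 * E)) *
        (1 - (-S - (b - a - E)) / (2 * E)) = 0
    · field_simp at h1 h2
      have hab : b - a = 0 := by
        have : S * (b - a) = 0 := by linear_combination (h1 - h2) / 16
        exact (mul_eq_zero.1 this).resolve_left hS0
      have hb : b = a := by linarith
      subst hb
      refine ⟨1 / 2, -E, by rw [neg_sq, hE], ?_, by norm_num⟩
      have : E * (E + 4 * b) = 0 := by nlinarith
      have := (mul_eq_zero.1 this).resolve_left hE0
      linarith
    · exact ⟨_, E, hE, root (-S) (neg_sq S), h2⟩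
  · exact ⟨_, E, hE, root S rfl, h1⟩

/-- **Every isosceles trapezoid is pedal equivalent to every square.** -/
theorem isoscelesTrapezoid_pedalEquiv_square
    (T V : ZMod 4 → Plane) (hT : IsIsoscelesTrapezoid T) (hV : IsSquareGon V) :
    PedalEquiv T V := by
  obtain ⟨p, w, v, hw, hv, hwv, a, b, s, t, ha, hb, hD, rfl⟩ := hT.exists_coordinates
  obtain ⟨r, E, hE, hr, hN⟩ := exists_kite_parameter (b := b) ha hD
  obtain ⟨D, rfl⟩ : ∃ D, t = s + D := ⟨t - s, by ring⟩
  rw [add_sub_cancel_left] at hD hE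
  have hr0 : r ≠ 0 := by
    rintro rfl
    exact ha (by linear_combination hr)
  have hr1 : 1 - r ≠ 0 := by
    intro h
    obtain rfl : r = 1 := by linarith
    exact hb (by linear_combination hr)
  have hE0 : E ≠ 0 := by
    rintro rfl
    exact hD (by simpa using hE.symm)
  obtain ⟨N, hNdef⟩ : ∃ N, N = 1 + 4 * r * (1 - r) := ⟨_, rfl⟩
  obtain ⟨q, hq⟩ : ∃ q, q = E * r * (1 - r) := ⟨_, rfl⟩
  rw [← hNdef] at hN
  rw [← hq] at hr
  have hq0 : q ≠ 0 := hq ▸ mul_ne_zero (mul_ne_zero hE0 hr0) hr1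
  have hq2 : q ^ 2 = 4 * D ^ 2 * r ^ 2 * (1 - r) ^ 2 := by
    rw [hq]; linear_combination r ^ 2 * (1 - r) ^ 2 * hE
  have hrD : r * D ≠ 0 := mul_ne_zero hr0 hD
  have hrD1 : (1 - r) * D ≠ 0 := mul_ne_zero hr1 hD
  let X₁ := framePoint p w v 0 (s + (r * ((b - a) ^ 2 + D ^ 2) + a * (b - a)) / D)
  let X₂ := framePoint p w v 0 (s + D * r * (1 + 4 * (1 - r) ^ 2) / N)
  have kite : pedal (quad (framePoint p w v (-a) s) (framePoint p w v a s)
      (framePoint p w v b (s + D)) (framePoint p w v (-b) (s + D))) X₁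
      = quad (framePoint p w v 0 s) (framePoint p w v q (s + r * D))
        (framePoint p w v 0 (s + D)) (framePoint p w v (-q) (s + r * D)) := by
    rw [pedal_quad]
    congr 1
    · refine foot_framePoint hw hv hwv (1 / 2) (Or.inl (fun h => ha (by linarith))) ?_ ?_ ?_ <;>
        ring
    · refine foot_framePoint hw hv hwv r (Or.inr (by simpa using hD)) ?_ hr.symm ?_
      · field_simp
        ring
      · ring
    · refine foot_framePoint hw hv hwv (1 / 2) (Or.inl (fun h => hb (by linarith))) ?_ ?_ ?_ <;>
        ring
    · refine foot_framePoint hw hv hwv (1 - r) (Or.inr (by simpa using hD)) ?_ ?_ ?_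
      · field_simp
        ring
      · linear_combination hr
      · ring
  have square : pedal (quad (framePoint p w v 0 s) (framePoint p w v q (s + r * D))
        (framePoint p w v 0 (s + D)) (framePoint p w v (-q) (s + r * D))) X₂
      = quad (framePoint p w v (q / N) (s + D * r / N))
        (framePoint p w v (q / N) (s + D - D * (1 - r) / N))
        (framePoint p w v (-(q / N)) (s + D - D * (1 - r) / N))
        (framePoint p w v (-(q / N)) (s + D * r / N)) := by
    rw [pedal_quad]
    congr 1
    · refine foot_framePoint hw hv hwv (1 / N) (Or.inl (by simpa using hq0)) ?_ ?_ ?_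
      · field_simp
        linear_combination -hq2
      · ring
      · ring
    · refine foot_framePoint hw hv hwv (1 - 1 / N) (Or.inl (by simpa using hq0)) ?_ ?_ ?_
      · field_simp
        rw [hNdef]
        linear_combination hq2
      · ring
      · ring
    · refine foot_framePoint hw hv hwv (1 / N) (Or.inl (by simpa using hq0)) ?_ ?_ ?_
      · field_simp
        rw [hNdef]
        linear_combination -hq2
      · ring
      · ring
    · refine foot_framePoint hw hv hwv (1 - 1 / N) (Or.inl (by simpa using hq0)) ?_ ?_ ?_
      · field_simp
        linear_combination hq2
      · ring
      · ring
  have kite_nondeg : NoThreeCollinear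
      (quad (framePoint p w v 0 s) (framePoint p w v q (s + r * D))
        (framePoint p w v 0 (s + D)) (framePoint p w v (-q) (s + r * D))) := by
    rw [noThreeCollinear_quad]
    refine ⟨?_, ?_, ?_, ?_⟩ <;> refine not_collinear_framePoint hw hv hwv ?_
    · convert mul_ne_zero hq0 hD using 1; ring
    · convert mul_ne_zero (mul_ne_zero two_ne_zero hq0) hrD1 using 1; ring
    · convert mul_ne_zero hq0 hD using 1; ring
    · convert mul_ne_zero (mul_ne_zero two_ne_zero hq0) hrD using 1; ring
  have is_square : IsSquareGon (quad (framePoint p w v (q / N) (s + D * r / N))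
        (framePoint p w v (q / N) (s + D - D * (1 - r) / N))
        (framePoint p w v (-(q / N)) (s + D - D * (1 - r) / N))
        (framePoint p w v (-(q / N)) (s + D * r / N))) := by
    have hside : (s + D * r / N - (s + D - D * (1 - r) / N)) ^ 2 = (2 * (q / N)) ^ 2 := by
      field_simp
      rw [hNdef]
      linear_combination -4 * hq2
    have hne : (2 * (q / N)) ^ 2 ≠ 0 :=
      pow_ne_zero 2 (mul_ne_zero two_ne_zero (div_ne_zero hq0 hN))
    apply isSquareGon_quad
    · rw [← dist_ne_zero, dist_framePoint hw hv hwv, hside]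
      rw [sub_self, zero_pow two_ne_zero, zero_add, Real.sqrt_sq_eq_abs, abs_ne_zero]
      exact (pow_ne_zero_iff two_ne_zero).1 hne
    · rw [inner_framePoint_sub hw hv hwv]; ring
    · rw [inner_framePoint_sub hw hv hwv]; ring
    · rw [inner_framePoint_sub hw hv hwv]; ring
    · rw [inner_framePoint_sub hw hv hwv]; ring
    · simp only [dist_framePoint hw hv hwv]; congr 1; linear_combination -hside
    · simp only [dist_framePoint hw hv hwv]; congr 1; ring
    · simp only [dist_framePoint hw hv hwv]; congr 1; linear_combination -hside
  refine ⟨2, by norm_num, fun k => if k = 1 then X₁ else X₂, ?_, ?_⟩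
  · intro k hk1 hk2
    interval_cases k
    · simpa [pedalSeq, kite] using kite_nondeg
    · simpa [pedalSeq, kite, square] using is_square.noThreeCollinear
  · simpa [pedalSeq, kite, square] using is_square.similarGon hV
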